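/- Completeness of the optimised algorithm: if a Gr(K_R)-formula φ in NNF is satisfiable, then there exists a sequence of applications of the optimised completion rules starting from {x₀ ⊨ φ} that results in a complete and clash-free constraint system. -/

import Mathlib

/-! Core definitions for the graded modal logic Gr(K_R):
syntax, Kripke semantics, NNF, closure, constraint systems,
and the completion rules (optimised and standard). -/

namespace GrK

/-- Gr(K_R)-formulae over propositional atoms (ℕ) and relation names (ℕ).
`ge r n φ` is the counting modality ⟨R⟩_{≥n}φ and `le r n φ` is ⟨R⟩_{≤n}φ. -/
inductive GFormula : Type where
  | atom : ℕ → GFormula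
  | neg  : GFormula → GFormula
  | and  : GFormula → GFormula → GFormula
  | or   : GFormula → GFormula → GFormula
  | ge   : ℕ → ℕ → GFormula → GFormula
  | le   : ℕ → ℕ → GFormula → GFormula
  deriving DecidableEq

/-- A Kripke structure: a nonempty type of worlds, an accessibility relation
for each relation name, and a valuation. -/
structure Kripke where
  W : Type
  nonempty : Nonempty W
  rel : ℕ → W → W → Prop
  val : ℕ → Set W

/-- Satisfaction `M, x ⊨ φ`; the graded modalities count successors
(as a cardinal, to handle infinite structures faithfully). -/
def GFormula.sat (M : Kripke) : GFormula → M.W → Prop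
  | .atom p, x => x ∈ M.val p
  | .neg φ, x => ¬ GFormula.sat M φ x
  | .and φ ψ, x => GFormula.sat M φ x ∧ GFormula.sat M ψ x
  | .or φ ψ, x => GFormula.sat M φ x ∨ GFormula.sat M ψ x
  | .ge r n φ, x => (n : Cardinal) ≤ Cardinal.mk {y : M.W // M.rel r x y ∧ GFormula.sat M φ y}
  | .le r n φ, x => Cardinal.mk {y : M.W // M.rel r x y ∧ GFormula.sat M φ y} ≤ (n : Cardinal)

/-- ♯R^M(x,φ): the number of R-successors of x satisfying φ. -/
def Kripke.count (M : Kripke) (r : ℕ) (x : M.W) (φ : GFormula) : Cardinal :=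
  Cardinal.mk {y : M.W // M.rel r x y ∧ GFormula.sat M φ y}

/-- A formula is satisfiable iff it holds at some world of some Kripke structure. -/
def GFormula.satisfiable (φ : GFormula) : Prop :=
  ∃ (M : Kripke) (x : M.W), GFormula.sat M φ x

/-- Negation normal form: negation occurs only in front of atoms. -/
def GFormula.isNNF : GFormula → Prop
  | .atom _ => True
  | .neg (.atom _) => True
  | .neg _ => False
  | .and φ ψ => GFormula.isNNF φ ∧ GFormula.isNNF ψ
  | .or φ ψ => GFormula.isNNF φ ∧ GFormula.isNNF ψ
  | .ge _ _ φ => GFormula.isNNF φ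
  | .le _ _ φ => GFormula.isNNF φ

/-- ~φ : the NNF of the negation of an NNF formula. -/
def GFormula.nnfNeg : GFormula → GFormula
  | .atom p => .neg (.atom p)
  | .neg φ => φ
  | .and φ ψ => .or φ.nnfNeg ψ.nnfNeg
  | .or φ ψ => .and φ.nnfNeg ψ.nnfNeg
  | .ge r n φ => if n = 0 then .and (.atom 0) (.neg (.atom 0)) else .le r (n - 1) φ
  | .le r n φ => .ge r (n + 1) φ

/-- |φ| : the length of a formula. -/
def GFormula.size : GFormula → ℕ
  | .atom _ => 1
  | .neg φ => 1 + φ.size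
  | .and φ ψ => 1 + φ.size + ψ.size
  | .or φ ψ => 1 + φ.size + ψ.size
  | .ge _ _ φ => 1 + φ.size
  | .le _ _ φ => 1 + φ.size

/-- sub(φ) : the set of subformulae of φ. -/
def GFormula.sub : GFormula → Finset GFormula
  | .atom p => {.atom p}
  | .neg φ => insert (.neg φ) φ.sub
  | .and φ ψ => insert (.and φ ψ) (φ.sub ∪ ψ.sub)
  | .or φ ψ => insert (.or φ ψ) (φ.sub ∪ ψ.sub)
  | .ge r n φ => insert (.ge r n φ) φ.sub
  | .le r n φ => insert (.le r n φ) φ.sub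

/-- Membership in clos(φ): the smallest set containing φ, closed under
immediate subformulae of ∧, ∨ and the graded modalities, and closed under ~. -/
inductive InClos (φ : GFormula) : GFormula → Prop
  | base : InClos φ φ
  | andL {ψ₁ ψ₂} : InClos φ (.and ψ₁ ψ₂) → InClos φ ψ₁
  | andR {ψ₁ ψ₂} : InClos φ (.and ψ₁ ψ₂) → InClos φ ψ₂
  | orL {ψ₁ ψ₂} : InClos φ (.or ψ₁ ψ₂) → InClos φ ψ₁
  | orR {ψ₁ ψ₂} : InClos φ (.or ψ₁ ψ₂) → InClos φ ψ₂
  | ge {r n ψ} : InClos φ (.ge r n ψ) → InClos φ ψ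
  | le {r n ψ} : InClos φ (.le r n ψ) → InClos φ ψ
  | nnfNeg {ψ} : InClos φ ψ → InClos φ ψ.nnfNeg

/-- clos(φ) as a set of formulae. -/
def clos (φ : GFormula) : Set GFormula := {ψ | InClos φ ψ}

/-- A constraint: either `x ⊨ ψ` or `R x y`;
a constraint system (c.s.) is a finite set of constraints. -/
inductive Constraint : Type where
  | sat : ℕ → GFormula → Constraint
  | rel : ℕ → ℕ → ℕ → Constraint
  deriving DecidableEq

/-- The variables occurring in a constraint. -/
def Constraint.vars : Constraint → Finset ℕ
  | .sat x _ => {x}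
  | .rel _ x y => {x, y}

/-- ♯R^S(x,ψ): the number of variables y with {Rxy, y ⊨ ψ} ⊆ S. -/
noncomputable def countS (S : Finset Constraint) (r x : ℕ) (ψ : GFormula) : ℕ :=
  Set.ncard {y : ℕ | Constraint.rel r x y ∈ S ∧ Constraint.sat y ψ ∈ S}

/-- A clash: {x ⊨ p, x ⊨ ¬p} ⊆ S, or x ⊨ ⟨R⟩_{≤n}ψ ∈ S with ♯R^S(x,ψ) > n. -/
def hasClash (S : Finset Constraint) : Prop :=
  (∃ x p, Constraint.sat x (.atom p) ∈ S ∧ Constraint.sat x (.neg (.atom p)) ∈ S) ∨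
  (∃ x r n ψ, Constraint.sat x (.le r n ψ) ∈ S ∧ n < countS S r x ψ)

/-- `y` is a fresh variable w.r.t. S. -/
def freshIn (y : ℕ) (S : Finset Constraint) : Prop := ∀ c ∈ S, y ∉ c.vars

/-- The →∧-rule is applicable to a constraint for x in S. -/
def andApplicable (S : Finset Constraint) (x : ℕ) : Prop :=
  ∃ ψ₁ ψ₂, Constraint.sat x (.and ψ₁ ψ₂) ∈ S ∧
    ¬ (Constraint.sat x ψ₁ ∈ S ∧ Constraint.sat x ψ₂ ∈ S)

/-- The →∨-rule is applicable to a constraint for x in S. -/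
def orApplicable (S : Finset Constraint) (x : ℕ) : Prop :=
  ∃ ψ₁ ψ₂, Constraint.sat x (.or ψ₁ ψ₂) ∈ S ∧
    Constraint.sat x ψ₁ ∉ S ∧ Constraint.sat x ψ₂ ∉ S

/-- One application of the →∧-rule. -/
inductive StepAnd : Finset Constraint → Finset Constraint → Prop
  | mk (S : Finset Constraint) (x : ℕ) (ψ₁ ψ₂ : GFormula)
      (h : Constraint.sat x (.and ψ₁ ψ₂) ∈ S)
      (h2 : ¬ (Constraint.sat x ψ₁ ∈ S ∧ Constraint.sat x ψ₂ ∈ S)) :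
      StepAnd S (insert (Constraint.sat x ψ₁) (insert (Constraint.sat x ψ₂) S))

/-- One application of the →∨-rule. -/
inductive StepOr : Finset Constraint → Finset Constraint → Prop
  | mk (S : Finset Constraint) (x : ℕ) (ψ₁ ψ₂ χ : GFormula)
      (h : Constraint.sat x (.or ψ₁ ψ₂) ∈ S)
      (h1 : Constraint.sat x ψ₁ ∉ S) (h2 : Constraint.sat x ψ₂ ∉ S)
      (hχ : χ = ψ₁ ∨ χ = ψ₂) :
      StepOr S (insert (Constraint.sat x χ) S)

/-- One application of the optimised →≥-rule: if x ⊨ ⟨R⟩_{≥n}ψ ∈ S,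
♯R^S(x,ψ) < n and no →∧/→∨ rule applies to a constraint for x, add (for a
fresh y) the constraints Rxy, y ⊨ ψ, and y ⊨ χᵢ with χᵢ ∈ {ψᵢ, ~ψᵢ} for every
ψᵢ occurring in a graded constraint ⟨R⟩_{⋈m}ψᵢ for x with the same relation R. -/
inductive StepGe : Finset Constraint → Finset Constraint → Prop
  | mk (S S' : Finset Constraint) (x r n : ℕ) (ψ : GFormula) (y : ℕ)
      (f : GFormula → GFormula)
      (h : Constraint.sat x (.ge r n ψ) ∈ S)
      (hc : countS S r x ψ < n)
      (hna : ¬ andApplicable S x) (hno : ¬ orApplicable S x)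
      (hy : freshIn y S)
      (hf : ∀ ψ', f ψ' = ψ' ∨ f ψ' = ψ'.nnfNeg)
      (hS' : (S' : Set Constraint) = (S : Set Constraint) ∪
          {Constraint.rel r x y, Constraint.sat y ψ} ∪
          {c | ∃ ψ' m,
            (Constraint.sat x (.ge r m ψ') ∈ S ∨ Constraint.sat x (.le r m ψ') ∈ S) ∧
            c = Constraint.sat y (f ψ')}) :
      StepGe S S'

/-- One application of any optimised completion rule. -/
def OptStep (S S' : Finset Constraint) : Prop := StepAnd S S' ∨ StepOr S S' ∨ StepGe S S'

/-- The initial constraint system {x₀ ⊨ φ}. -/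
def initCS (x₀ : ℕ) (φ : GFormula) : Finset Constraint := {Constraint.sat x₀ φ}

/-- S is obtained from {x₀ ⊨ φ} by a sequence of optimised rule applications. -/
def OptReach (x₀ : ℕ) (φ : GFormula) (S : Finset Constraint) : Prop :=
  Relation.ReflTransGen OptStep (initCS x₀ φ) S

/-- A c.s. is complete iff no optimised rule is applicable. -/
def OptComplete (S : Finset Constraint) : Prop := ¬ ∃ S', OptStep S S'

/-- The edges of the graph G(S) induced by a c.s. S. -/
def edge (S : Finset Constraint) (x y : ℕ) : Prop := ∃ r, Constraint.rel r x y ∈ S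

/-- The variable x occurs in S (x is a node of G(S)). -/
def occursIn (x : ℕ) (S : Finset Constraint) : Prop := ∃ c ∈ S, x ∈ c.vars

/-- Satisfiability of a constraint system. -/
def csSat (S : Finset Constraint) : Prop :=
  ∃ (M : Kripke) (α : ℕ → M.W),
    (∀ r x y z, Constraint.rel r x y ∈ S → Constraint.rel r x z ∈ S → y ≠ z → α y ≠ α z) ∧
    (∀ x ψ, Constraint.sat x ψ ∈ S → GFormula.sat M ψ (α x)) ∧
    (∀ r x y, Constraint.rel r x y ∈ S → M.rel r (α x) (α y))

/-- The canonical structure M_S induced by a c.s. S (on the variables,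
with accessibility and valuation read off from S). -/
def canonical (S : Finset Constraint) : Kripke where
  W := ℕ
  nonempty := ⟨0⟩
  rel := fun r x y => Constraint.rel r x y ∈ S
  val := fun p => {x | Constraint.sat x (.atom p) ∈ S}

/-- Renaming a variable: `rename y z c` replaces y by z in the constraint c. -/
def Constraint.rename (y z : ℕ) : Constraint → Constraint
  | .sat x ψ => .sat (if x = y then z else x) ψ
  | .rel r a b => .rel r (if a = y then z else a) (if b = y then z else b)

/-- [z/y]S : replace every occurrence of y by z in S. -/
def renameCS (S : Finset Constraint) (y z : ℕ) : Finset Constraint :=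
  S.image (Constraint.rename y z)

/-- The replacement of y by z in S is safe. -/
def safeReplace (S : Finset Constraint) (y z : ℕ) : Prop :=
  ∀ x r n ψ, Constraint.sat x (.ge r n ψ) ∈ S → Constraint.rel r x y ∈ S →
    Constraint.rel r x z ∈ S → n ≤ countS (renameCS S y z) r x ψ

/-- One application of a standard (Hollunder–Baader) completion rule. -/
inductive StdStep : Finset Constraint → Finset Constraint → Prop
  | and (S : Finset Constraint) (x : ℕ) (ψ₁ ψ₂ : GFormula)
      (h : Constraint.sat x (.and ψ₁ ψ₂) ∈ S)
      (h2 : ¬ (Constraint.sat x ψ₁ ∈ S ∧ Constraint.sat x ψ₂ ∈ S)) :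
      StdStep S (insert (Constraint.sat x ψ₁) (insert (Constraint.sat x ψ₂) S))
  | or (S : Finset Constraint) (x : ℕ) (ψ₁ ψ₂ χ : GFormula)
      (h : Constraint.sat x (.or ψ₁ ψ₂) ∈ S)
      (h1 : Constraint.sat x ψ₁ ∉ S) (h2 : Constraint.sat x ψ₂ ∉ S)
      (hχ : χ = ψ₁ ∨ χ = ψ₂) :
      StdStep S (insert (Constraint.sat x χ) S)
  | choose (S : Finset Constraint) (x r n : ℕ) (ψ χ : GFormula) (y : ℕ)
      (h : Constraint.sat x (.ge r n ψ) ∈ S ∨ Constraint.sat x (.le r n ψ) ∈ S)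
      (hr : Constraint.rel r x y ∈ S)
      (h1 : Constraint.sat y ψ ∉ S) (h2 : Constraint.sat y ψ.nnfNeg ∉ S)
      (hχ : χ = ψ ∨ χ = ψ.nnfNeg) :
      StdStep S (insert (Constraint.sat y χ) S)
  | ge (S : Finset Constraint) (x r n : ℕ) (ψ : GFormula) (y : ℕ)
      (h : Constraint.sat x (.ge r n ψ) ∈ S)
      (hc : countS S r x ψ < n)
      (hy : freshIn y S) :
      StdStep S (insert (Constraint.rel r x y) (insert (Constraint.sat y ψ) S))
  | le (S : Finset Constraint) (x r n : ℕ) (ψ : GFormula) (y z : ℕ)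
      (h : Constraint.sat x (.le r n ψ) ∈ S)
      (hc : n < countS S r x ψ)
      (hyz : y ≠ z)
      (h1 : Constraint.rel r x y ∈ S) (h2 : Constraint.rel r x z ∈ S)
      (h3 : Constraint.sat y ψ ∈ S) (h4 : Constraint.sat z ψ ∈ S)
      (hsafe : safeReplace S y z) :
      StdStep S (renameCS S y z)

/-- S is obtained from {x₀ ⊨ φ} by a sequence of standard rule applications. -/
def StdReach (x₀ : ℕ) (φ : GFormula) (S : Finset Constraint) : Prop :=
  Relation.ReflTransGen StdStep (initCS x₀ φ) S

/-- A c.s. is complete (for the standard rules) iff no rule is applicable. -/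
def StdComplete (S : Finset Constraint) : Prop := ¬ ∃ S', StdStep S S'

end GrK

namespace GrK

/-- modal depth -/
def md : GFormula → ℕ
  | .atom _ => 0
  | .neg φ => md φ
  | .and φ ψ => max (md φ) (md ψ)
  | .or φ ψ => max (md φ) (md ψ)
  | .ge _ _ φ => md φ + 1
  | .le _ _ φ => md φ + 1

theorem md_nnfNeg (ψ : GFormula) : md ψ.nnfNeg ≤ md ψ := by
  induction ψ with
  | atom p => simp [GFormula.nnfNeg, md]
  | neg φ ih => simp [GFormula.nnfNeg, md]
  | and φ ψ ih1 ih2 => simp only [GFormula.nnfNeg, md]; omega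
  | or φ ψ ih1 ih2 => simp only [GFormula.nnfNeg, md]; omega
  | ge r n φ ih =>
    simp only [GFormula.nnfNeg]
    split_ifs <;> simp [md]
  | le r n φ ih => simp [GFormula.nnfNeg, md]

theorem sat_nnfNeg (M : Kripke) (ψ : GFormula) (x : M.W) :
    GFormula.sat M ψ.nnfNeg x ↔ ¬ GFormula.sat M ψ x := by
  induction ψ generalizing x with
  | atom p => simp [GFormula.nnfNeg, GFormula.sat]
  | neg φ ih => simp [GFormula.nnfNeg, GFormula.sat]
  | and φ ψ ih1 ih2 => simp only [GFormula.nnfNeg, GFormula.sat, ih1, ih2]; tauto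
  | or φ ψ ih1 ih2 => simp only [GFormula.nnfNeg, GFormula.sat, ih1, ih2]; tauto
  | ge r n φ ih =>
    simp only [GFormula.nnfNeg]
    split_ifs with h
    · subst h; simp [GFormula.sat]
    · simp only [GFormula.sat, not_le]
      obtain ⟨k, rfl⟩ := Nat.exists_eq_succ_of_ne_zero h
      simp only [Nat.succ_eq_add_one, Nat.add_sub_cancel]
      rw [← Order.lt_succ_iff, Cardinal.succ_natCast]
      push_cast
      rfl
  | le r n φ ih =>
    simp only [GFormula.nnfNeg, GFormula.sat, not_le]
    rw [← Order.succ_le_iff, Cardinal.succ_natCast]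
    push_cast
    rfl

theorem self_mem_sub (χ : GFormula) : χ ∈ χ.sub := by
  cases χ <;> simp [GFormula.sub]

theorem md_sub (χ ψ : GFormula) (h : ψ ∈ χ.sub) : md ψ ≤ md χ := by
  induction χ with
  | atom p => simp [GFormula.sub] at h; subst h; rfl
  | neg φ ih =>
    simp only [GFormula.sub, Finset.mem_insert] at h
    rcases h with rfl | h
    · rfl
    · exact ih h
  | and a b ih1 ih2 =>
    simp only [GFormula.sub, Finset.mem_insert, Finset.mem_union] at h
    rcases h with rfl | h | h
    · rfl
    · exact (ih1 h).trans (le_max_left _ _)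
    · exact (ih2 h).trans (le_max_right _ _)
  | or a b ih1 ih2 =>
    simp only [GFormula.sub, Finset.mem_insert, Finset.mem_union] at h
    rcases h with rfl | h | h
    · rfl
    · exact (ih1 h).trans (le_max_left _ _)
    · exact (ih2 h).trans (le_max_right _ _)
  | ge r n φ ih =>
    simp only [GFormula.sub, Finset.mem_insert] at h
    rcases h with rfl | h
    · rfl
    · exact (ih h).trans (Nat.le_succ _)
  | le r n φ ih =>
    simp only [GFormula.sub, Finset.mem_insert] at h
    rcases h with rfl | h
    · rfl
    · exact (ih h).trans (Nat.le_succ _)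

/-- closed under conjuncts and disjuncts -/
def Closed (C : Set GFormula) : Prop :=
  ∀ a b, (GFormula.and a b ∈ C ∨ GFormula.or a b ∈ C) → a ∈ C ∧ b ∈ C

theorem closed_sub (χ : GFormula) : Closed {ψ | ψ ∈ χ.sub} := by
  intro a b h
  simp only [Set.mem_ofPred_eq] at *
  induction χ with
  | atom p => simp [GFormula.sub] at h
  | neg φ ih => simp [GFormula.sub] at h ⊢; tauto
  | and c d ih1 ih2 =>
    have := self_mem_sub c
    have := self_mem_sub d
    simp [GFormula.sub] at h ⊢
    grind
  | or c d ih1 ih2 =>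
    have := self_mem_sub c
    have := self_mem_sub d
    simp [GFormula.sub] at h ⊢
    grind
  | ge r n φ ih => simp [GFormula.sub] at h ⊢; tauto
  | le r n φ ih => simp [GFormula.sub] at h ⊢; tauto

theorem fin_succ (S : Finset Constraint) (r x : ℕ) (ψ : GFormula) :
    {y : ℕ | Constraint.rel r x y ∈ S ∧ Constraint.sat y ψ ∈ S}.Finite := by
  have : {y : ℕ | Constraint.rel r x y ∈ S}.Finite := by
    refine Set.Finite.preimage (f := fun y => Constraint.rel r x y) ?_ S.finite_toSet
    intro a _ b _ h
    simpa using h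
  exact this.subset fun y h => h.1

theorem countS_mono {S S' : Finset Constraint} (h : S ⊆ S') (r x : ℕ) (ψ : GFormula) :
    countS S r x ψ ≤ countS S' r x ψ :=
  Set.ncard_le_ncard (fun _ hy => ⟨h hy.1, h hy.2⟩) (fin_succ _ _ _ _)

/-- outstanding successors -/
noncomputable def deficit (S : Finset Constraint) (x : ℕ) : GFormula → ℕ
  | .ge r n ψ => n - countS S r x ψ
  | _ => 0

theorem deficit_mono {S S' : Finset Constraint} (h : S ⊆ S') (x : ℕ) (ψ : GFormula) :
    deficit S' x ψ ≤ deficit S x ψ := by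
  cases ψ <;> simp only [deficit, le_refl]
  exact Nat.sub_le_sub_left (countS_mono h _ _ _) _

/-- pointwise cost -/
noncomputable def cost1 (S : Finset Constraint) (x : ℕ) (χ : GFormula) : ℕ :=
  (if Constraint.sat x χ ∈ S then 0 else 1) + deficit S x χ

theorem cost1_mono {S S' : Finset Constraint} (h : S ⊆ S') (x : ℕ) (ψ : GFormula) :
    cost1 S' x ψ ≤ cost1 S x ψ := by
  have := deficit_mono h x ψ
  unfold cost1
  have h2 := @h (Constraint.sat x ψ)
  split_ifs <;> first | omega | (exfalso; tauto)

/-- labels of x lie in a closed finite set of modal depth at most d with cost at most b -/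
def Bnd (S : Finset Constraint) (x : ℕ) (p : ℕ × ℕ) : Prop :=
  ∃ C : Finset GFormula, Closed {ψ | ψ ∈ C} ∧ (∀ ψ, Constraint.sat x ψ ∈ S → ψ ∈ C) ∧
    (∀ ψ ∈ C, md ψ ≤ p.1) ∧ ∑ χ ∈ C, cost1 S x χ ≤ p.2

theorem Bnd.exists (S : Finset Constraint) (x d : ℕ)
    (h : ∀ ψ, Constraint.sat x ψ ∈ S → md ψ ≤ d) : ∃ b, Bnd S x (d, b) := by
  have hfin : {ψ | Constraint.sat x ψ ∈ S}.Finite := by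
    refine Set.Finite.preimage (f := fun y => Constraint.sat x y) ?_ S.finite_toSet
    intro a _ b _ h
    simpa using h
  refine ⟨_, hfin.toFinset.biUnion GFormula.sub, ?_, ?_, ?_, le_rfl⟩
  · intro a b hab
    simp only [Set.mem_ofPred_eq, Finset.mem_biUnion, Set.Finite.mem_toFinset] at hab ⊢
    rcases hab with ⟨c, hc, h1⟩ | ⟨c, hc, h1⟩
    · have := closed_sub c a b (Or.inl h1)
      exact ⟨⟨c, hc, this.1⟩, ⟨c, hc, this.2⟩⟩
    · have := closed_sub c a b (Or.inr h1)
      exact ⟨⟨c, hc, this.1⟩, ⟨c, hc, this.2⟩⟩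
  · intro ψ hψ
    simp only [Finset.mem_biUnion, Set.Finite.mem_toFinset]
    exact ⟨ψ, hψ, self_mem_sub ψ⟩
  · intro ψ hψ
    simp only [Finset.mem_biUnion, Set.Finite.mem_toFinset] at hψ
    obtain ⟨c, hc, h1⟩ := hψ
    exact (md_sub _ _ h1).trans (h c hc)

theorem Bnd.mono {S S' : Finset Constraint} {x : ℕ} {p : ℕ × ℕ} (h : Bnd S x p) (hS : S ⊆ S')
    (hL : ∀ ψ, Constraint.sat x ψ ∈ S' → Constraint.sat x ψ ∈ S) : Bnd S' x p := by
  obtain ⟨C, h1, h2, h3, h4⟩ := h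
  exact ⟨C, h1, fun ψ hψ => h2 ψ (hL ψ hψ), h3,
    (Finset.sum_le_sum fun χ _ => cost1_mono hS x χ).trans h4⟩

theorem Bnd.strict {S S' : Finset Constraint} {x : ℕ} {p : ℕ × ℕ} (h : Bnd S x p) (hS : S ⊆ S')
    (hL : ∀ C : Set GFormula, Closed C → (∀ ψ, Constraint.sat x ψ ∈ S → ψ ∈ C) →
      ∀ ψ, Constraint.sat x ψ ∈ S' → ψ ∈ C)
    (hlt : ∃ χ, Constraint.sat x χ ∈ S' ∧ cost1 S' x χ < cost1 S x χ) :
    ∃ b < p.2, Bnd S' x (p.1, b) := by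
  obtain ⟨C, h1, h2, h3, h4⟩ := h
  have hC := hL _ h1 h2
  obtain ⟨χ, hχ, hlt⟩ := hlt
  exact ⟨_, lt_of_lt_of_le (Finset.sum_lt_sum (fun χ _ => cost1_mono hS x χ)
    ⟨χ, hC χ hχ, hlt⟩) h4, C, h1, hC, h3, le_rfl⟩

/-- The invariant. -/
structure Inv (M : Kripke) (S : Finset Constraint) (V : Finset ℕ) (α : ℕ → M.W)
    (μ : ℕ → ℕ × ℕ) : Prop where
  inj : ∀ r x y z, Constraint.rel r x y ∈ S → Constraint.rel r x z ∈ S → y ≠ z → α y ≠ α z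
  sats : ∀ x ψ, Constraint.sat x ψ ∈ S → GFormula.sat M ψ (α x)
  rels : ∀ r x y, Constraint.rel r x y ∈ S → M.rel r (α x) (α y)
  choice : ∀ r x y n ψ, Constraint.rel r x y ∈ S →
    (Constraint.sat x (.ge r n ψ) ∈ S ∨ Constraint.sat x (.le r n ψ) ∈ S) →
    Constraint.sat y ψ ∈ S ∨ Constraint.sat y ψ.nnfNeg ∈ S
  noapp : ∀ r x y, Constraint.rel r x y ∈ S → ¬ (andApplicable S x ∨ orApplicable S x)
  vsat : ∀ x ψ, Constraint.sat x ψ ∈ S → x ∈ V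
  vrel : ∀ r x y, Constraint.rel r x y ∈ S → x ∈ V ∧ y ∈ V
  bnd : ∀ x ∈ V, Bnd S x (μ x)

theorem Inv.noClash {M S V α μ} (I : Inv M S V α μ) : ¬ hasClash S := by
  rintro (⟨x, p, h1, h2⟩ | ⟨x, r, n, ψ, h1, h2⟩)
  · exact I.sats _ _ h2 (I.sats _ _ h1)
  · have hle := I.sats _ _ h1
    simp only [GFormula.sat] at hle
    have hfin := fin_succ S r x ψ
    have e1 := Set.cast_ncard hfin
    have hinj : Set.InjOn α {y : ℕ | Constraint.rel r x y ∈ S ∧ Constraint.sat y ψ ∈ S} := by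
      intro a ha b hb hab
      by_contra hne
      exact I.inj r x a b ha.1 hb.1 hne hab
    have e2 := Cardinal.mk_image_eq_of_injOn α _ hinj
    have e3 : Cardinal.mk (α '' {y : ℕ | Constraint.rel r x y ∈ S ∧ Constraint.sat y ψ ∈ S}) ≤
        Cardinal.mk {y : M.W | M.rel r (α x) y ∧ GFormula.sat M ψ y} := by
      apply Cardinal.mk_le_mk_of_subset
      rintro _ ⟨y, hy, rfl⟩
      exact ⟨I.rels _ _ _ hy.1, I.sats _ _ hy.2⟩
    have e4 : ((countS S r x ψ : ℕ) : Cardinal) ≤ n := by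
      unfold countS
      rw [e1, ← e2]
      exact e3.trans hle
    have e5 : countS S r x ψ ≤ n := by exact_mod_cast e4
    omega

theorem exists_world {M S V α μ} (I : Inv M S V α μ) {r x n ψ}
    (h : Constraint.sat x (.ge r n ψ) ∈ S) (hc : countS S r x ψ < n) :
    ∃ w, M.rel r (α x) w ∧ GFormula.sat M ψ w ∧ ∀ y, Constraint.rel r x y ∈ S → α y ≠ w := by
  by_contra hcon
  push Not at hcon
  have hge := I.sats _ _ h
  simp only [GFormula.sat] at hge
  have hfin := fin_succ S r x ψ
  have e1 := Set.cast_ncard hfin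
  have e3 : Cardinal.mk {y : M.W | M.rel r (α x) y ∧ GFormula.sat M ψ y} ≤
      Cardinal.mk (α '' {y : ℕ | Constraint.rel r x y ∈ S ∧ Constraint.sat y ψ ∈ S}) := by
    apply Cardinal.mk_le_mk_of_subset
    rintro w ⟨hw1, hw2⟩
    obtain ⟨y, hy, rfl⟩ := hcon w hw1 hw2
    refine ⟨y, ⟨hy, ?_⟩, rfl⟩
    rcases I.choice r x y n ψ hy (Or.inl h) with h' | h'
    · exact h'
    · exact absurd hw2 ((sat_nnfNeg M ψ _).1 (I.sats _ _ h'))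
  have e4 : (n : Cardinal) ≤ ((countS S r x ψ : ℕ) : Cardinal) := by
    unfold countS
    rw [e1]
    exact hge.trans (e3.trans Cardinal.mk_image_le)
  have e5 : n ≤ countS S r x ψ := by exact_mod_cast e4
  omega

/-- multiset measure -/
def meas (V : Finset ℕ) (μ : ℕ → ℕ × ℕ) : Multiset (ℕ × ℕ) := ∑ x ∈ V, {μ x}

/-- the lexicographic order -/
def lx : ℕ × ℕ → ℕ × ℕ → Prop := Prod.Lex (· < ·) (· < ·)

theorem lx_wf : WellFounded lx := WellFounded.prod_lex wellFounded_lt wellFounded_lt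

theorem meas_local (V : Finset ℕ) (μ : ℕ → ℕ × ℕ) (x : ℕ) (hx : x ∈ V) (q : ℕ × ℕ)
    (hq : lx q (μ x)) : Relation.CutExpand lx (meas V (Function.update μ x q)) (meas V μ) := by
  refine ⟨{q}, μ x, by simpa using hq, ?_⟩
  unfold meas
  rw [← Finset.add_sum_erase V _ hx, ← Finset.add_sum_erase V (fun z => {μ z}) hx]
  have : ∑ z ∈ V.erase x, ({Function.update μ x q z} : Multiset (ℕ × ℕ)) =
      ∑ z ∈ V.erase x, {μ z} := by
    refine Finset.sum_congr rfl fun z hz => ?_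
    rw [Function.update_of_ne (Finset.ne_of_mem_erase hz)]
  rw [this, Function.update_self]
  abel

theorem meas_new (V : Finset ℕ) (μ : ℕ → ℕ × ℕ) (x y : ℕ) (hx : x ∈ V) (hy : y ∉ V)
    (q p : ℕ × ℕ) (hq : lx q (μ x)) (hp : lx p (μ x)) :
    Relation.CutExpand lx (meas (insert y V) (Function.update (Function.update μ x q) y p))
      (meas V μ) := by
  refine ⟨{q} + {p}, μ x, by
    intro a ha
    simp only [Multiset.mem_add, Multiset.mem_singleton] at ha
    rcases ha with rfl | rfl <;> assumption, ?_⟩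
  unfold meas
  rw [Finset.sum_insert hy, ← Finset.add_sum_erase V _ hx,
    ← Finset.add_sum_erase V (fun z => {μ z}) hx]
  have hxy : x ≠ y := fun h => hy (h ▸ hx)
  have : ∑ z ∈ V.erase x, ({Function.update (Function.update μ x q) y p z} :
      Multiset (ℕ × ℕ)) = ∑ z ∈ V.erase x, {μ z} := by
    refine Finset.sum_congr rfl fun z hz => ?_
    have h1 : z ≠ y := fun h => hy (h ▸ Finset.mem_of_mem_erase hz)
    rw [Function.update_of_ne h1, Function.update_of_ne (Finset.ne_of_mem_erase hz)]
  rw [this, Function.update_self, Function.update_of_ne hxy, Function.update_self]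
  abel

theorem app_congr {S S' : Finset Constraint} {x : ℕ}
    (h : ∀ ψ, Constraint.sat x ψ ∈ S' ↔ Constraint.sat x ψ ∈ S) :
    (andApplicable S' x ∨ orApplicable S' x) ↔ (andApplicable S x ∨ orApplicable S x) := by
  simp only [andApplicable, orApplicable, h]

theorem Inv.localStep {M S V α μ} (I : Inv M S V α μ) (S' : Finset Constraint) (x : ℕ)
    (happ : andApplicable S x ∨ orApplicable S x) (hS : S ⊆ S') (T : Set GFormula)
    (hS' : ∀ c ∈ S', c ∈ S ∨ ∃ ψ ∈ T, c = Constraint.sat x ψ)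
    (hT : ∀ ψ ∈ T, GFormula.sat M ψ (α x))
    (hcl : ∀ C : Set GFormula, Closed C → (∀ ψ, Constraint.sat x ψ ∈ S → ψ ∈ C) →
      ∀ ψ ∈ T, ψ ∈ C)
    (hnew : ∃ ψ, Constraint.sat x ψ ∈ S' ∧ Constraint.sat x ψ ∉ S) :
    ∃ μ', Inv M S' V α μ' ∧ Relation.CutExpand lx (meas V μ') (meas V μ) := by
  have hx : x ∈ V := by
    rcases happ with ⟨a, b, h, -⟩ | ⟨a, b, h, -⟩ <;> exact I.vsat _ _ h
  have hrel : ∀ r a b, Constraint.rel r a b ∈ S' → Constraint.rel r a b ∈ S := by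
    intro r a b h
    rcases hS' _ h with h | ⟨ψ, -, h⟩
    · exact h
    · cases h
  have hsat : ∀ a, a ≠ x → ∀ ψ, (Constraint.sat a ψ ∈ S' ↔ Constraint.sat a ψ ∈ S) := by
    intro a ha ψ
    refine ⟨fun h => ?_, fun h => hS h⟩
    rcases hS' _ h with h | ⟨ψ, -, h⟩
    · exact h
    · cases h; exact absurd rfl ha
  have hne : ∀ r a b, Constraint.rel r a b ∈ S' → a ≠ x := by
    rintro r a b h rfl
    exact I.noapp _ _ _ (hrel _ _ _ h) happ
  obtain ⟨b, hb, hB⟩ := (I.bnd x hx).strict hS (by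
    intro C h1 h2 ψ hψ
    rcases hS' _ hψ with h | ⟨ψ', h, he⟩
    · exact h2 _ h
    · cases he; exact hcl C h1 h2 _ h) (by
    obtain ⟨ψ, h1, h2⟩ := hnew
    refine ⟨ψ, h1, ?_⟩
    have := deficit_mono hS x ψ
    simp only [cost1, h1, h2, if_true, if_false]
    omega)
  refine ⟨Function.update μ x ((μ x).1, b), ⟨?_, ?_, ?_, ?_, ?_, ?_, ?_, ?_⟩,
    meas_local V μ x hx _ (Prod.Lex.right _ hb)⟩
  · intro r a y z h1 h2
    exact I.inj r a y z (hrel _ _ _ h1) (hrel _ _ _ h2)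
  · intro a ψ h
    rcases hS' _ h with h | ⟨ψ, h', h⟩
    · exact I.sats _ _ h
    · cases h; exact hT _ h'
  · intro r a y h
    exact I.rels _ _ _ (hrel _ _ _ h)
  · intro r a y n ψ h hg
    have ha := hne _ _ _ h
    rw [hsat a ha, hsat a ha] at hg
    exact (I.choice r a y n ψ (hrel _ _ _ h) hg).imp (fun h => hS h) (fun h => hS h)
  · intro r a y h
    rw [app_congr (hsat a (hne _ _ _ h))]
    exact I.noapp _ _ _ (hrel _ _ _ h)
  · intro a ψ h
    rcases hS' _ h with h | ⟨ψ, h', h⟩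
    · exact I.vsat _ _ h
    · cases h; exact hx
  · intro r a y h
    exact I.vrel _ _ _ (hrel _ _ _ h)
  · intro a ha
    by_cases hax : a = x
    · subst hax; simpa using hB
    · rw [Function.update_of_ne hax]
      exact (I.bnd a ha).mono hS fun ψ h => (hsat a hax ψ).1 h

theorem Inv.geStep {M S V α μ} (I : Inv M S V α μ) {r x n ψ}
    (h : Constraint.sat x (.ge r n ψ) ∈ S) (hc : countS S r x ψ < n)
    (hna : ¬ andApplicable S x) (hno : ¬ orApplicable S x) :
    ∃ S' V' α' μ', StepGe S S' ∧ Inv M S' V' α' μ' ∧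
      Relation.CutExpand lx (meas V' μ') (meas V μ) := by
  classical
  obtain ⟨w, hw1, hw2, hw3⟩ := exists_world I h hc
  obtain ⟨y, hy⟩ := Infinite.exists_notMem_finset V
  have hx : x ∈ V := I.vsat _ _ h
  have hxy : x ≠ y := fun e => hy (e ▸ hx)
  let f : GFormula → GFormula := fun χ => if GFormula.sat M χ w then χ else χ.nnfNeg
  have hf : ∀ χ, f χ = χ ∨ f χ = χ.nnfNeg := by
    intro χ; by_cases hs : GFormula.sat M χ w <;> simp [f, hs]
  have hfw : ∀ χ, GFormula.sat M (f χ) w := by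
    intro χ
    by_cases hs : GFormula.sat M χ w
    · simp [f, hs]
    · simp only [f, hs, if_false]; exact (sat_nnfNeg M χ w).2 hs
  have hfmd : ∀ χ, md (f χ) ≤ md χ := by
    intro χ
    rcases hf χ with e | e <;> rw [e]
    exact md_nnfNeg χ
  have hfin : ({c | ∃ ψ' m,
      (Constraint.sat x (.ge r m ψ') ∈ S ∨ Constraint.sat x (.le r m ψ') ∈ S) ∧
      c = Constraint.sat y (f ψ')}).Finite := by
    let g : Constraint → Constraint := fun c => match c with
      | .sat _ (.ge _ _ ψ') => .sat y (f ψ')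
      | .sat _ (.le _ _ ψ') => .sat y (f ψ')
      | c => c
    refine (S.finite_toSet.image g).subset ?_
    rintro c ⟨ψ', m, h' | h', rfl⟩
    · exact ⟨_, h', rfl⟩
    · exact ⟨_, h', rfl⟩
  obtain ⟨S', hS'⟩ : ∃ S' : Finset Constraint, (S' : Set Constraint) = (S : Set Constraint) ∪
          {Constraint.rel r x y, Constraint.sat y ψ} ∪
          {c | ∃ ψ' m,
            (Constraint.sat x (.ge r m ψ') ∈ S ∨ Constraint.sat x (.le r m ψ') ∈ S) ∧
            c = Constraint.sat y (f ψ')} := by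
    refine ⟨((S.finite_toSet.union (Set.toFinite
      {Constraint.rel r x y, Constraint.sat y ψ})).union hfin).toFinset, ?_⟩
    rw [Set.Finite.coe_toFinset]
  have hmem : ∀ c, c ∈ S' ↔ (c ∈ S ∨ c = Constraint.rel r x y ∨ c = Constraint.sat y ψ) ∨
      ∃ ψ' m, (Constraint.sat x (.ge r m ψ') ∈ S ∨ Constraint.sat x (.le r m ψ') ∈ S) ∧
            c = Constraint.sat y (f ψ') := by
    intro c
    rw [← Finset.mem_coe, hS']
    simp only [Set.mem_union, Set.mem_insert_iff, Set.mem_singleton_iff, Finset.mem_coe,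
      Set.mem_ofPred_eq]
  have hfresh : freshIn y S := by
    intro c hcS hyc
    cases c with
    | sat a χ =>
      simp only [Constraint.vars, Finset.mem_singleton] at hyc
      subst hyc; exact hy (I.vsat _ _ hcS)
    | rel r a b =>
      simp only [Constraint.vars, Finset.mem_insert, Finset.mem_singleton] at hyc
      have := I.vrel _ _ _ hcS
      rcases hyc with rfl | rfl
      · exact hy this.1
      · exact hy this.2
  have hS : S ⊆ S' := fun c hcS => (hmem c).2 (Or.inl (Or.inl hcS))
  have hsat : ∀ a, a ≠ y → ∀ χ, (Constraint.sat a χ ∈ S' ↔ Constraint.sat a χ ∈ S) := by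
    intro a ha χ
    refine ⟨fun h => ?_, fun h => hS h⟩
    rcases (hmem _).1 h with (h | h | h) | ⟨_, _, _, h⟩
    · exact h
    · cases h
    · cases h; exact absurd rfl ha
    · cases h; exact absurd rfl ha
  have hrel : ∀ r' a b, Constraint.rel r' a b ∈ S' →
      Constraint.rel r' a b ∈ S ∨ (r' = r ∧ a = x ∧ b = y) := by
    intro r' a b h
    rcases (hmem _).1 h with (h | h | h) | ⟨_, _, _, h⟩
    · exact Or.inl h
    · cases h; exact Or.inr ⟨rfl, rfl, rfl⟩
    · cases h
    · cases h
  have hsaty : ∀ χ, Constraint.sat y χ ∈ S' → χ = ψ ∨ ∃ ψ' m, (Constraint.sat x (.ge r m ψ') ∈ S ∨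
      Constraint.sat x (.le r m ψ') ∈ S) ∧ χ = f ψ' := by
    intro χ h
    rcases (hmem _).1 h with (h | h | h) | ⟨ψ', m, h', h⟩
    · exact absurd (I.vsat _ _ h) hy
    · cases h
    · cases h; exact Or.inl rfl
    · cases h; exact Or.inr ⟨ψ', m, h', rfl⟩
  have hdx : ∀ χ, Constraint.sat x χ ∈ S → md χ ≤ (μ x).1 := by
    intro χ hχ
    obtain ⟨C, -, h2, h3, -⟩ := I.bnd x hx
    exact h3 _ (h2 _ hχ)
  have hdy : ∀ χ, Constraint.sat y χ ∈ S' → md χ ≤ (μ x).1 - 1 := by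
    intro χ hχ
    rcases hsaty χ hχ with rfl | ⟨ψ', m, h' | h', rfl⟩
    · have := hdx _ h
      simp only [md] at this; omega
    · have := hdx _ h'
      have := hfmd ψ'
      simp only [md] at *; omega
    · have := hdx _ h'
      have := hfmd ψ'
      simp only [md] at *; omega
  have hpos : (μ x).1 - 1 < (μ x).1 := by
    have := hdx _ h
    simp only [md] at this; omega
  obtain ⟨bY, hBy⟩ := Bnd.exists S' y _ hdy
  have hcount : countS S r x ψ < countS S' r x ψ := by
    refine Set.ncard_lt_ncard ?_ (fin_succ _ _ _ _)
    refine ⟨fun z hz => ⟨hS hz.1, hS hz.2⟩, fun hsub => ?_⟩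
    have : y ∈ {z : ℕ | Constraint.rel r x z ∈ S ∧ Constraint.sat z ψ ∈ S} :=
      hsub ⟨(hmem _).2 (by simp), (hmem _).2 (by simp)⟩
    exact hy (I.vrel _ _ _ this.1).2
  obtain ⟨b, hb, hB⟩ := (I.bnd x hx).strict hS (by
    intro C h1 h2 χ hχ
    exact h2 _ ((hsat x hxy χ).1 hχ)) (by
    refine ⟨_, hS h, ?_⟩
    simp only [cost1, hS h, h, if_true, deficit]
    omega)
  refine ⟨S', insert y V, Function.update α y w,
    Function.update (Function.update μ x ((μ x).1, b)) y ((μ x).1 - 1, bY),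
    StepGe.mk S S' x r n ψ y f h hc hna hno hfresh hf hS', ?_,
    meas_new V μ x y hx hy _ _ (Prod.Lex.right _ hb) (Prod.Lex.left _ _ hpos)⟩
  have hα : ∀ a ∈ V, Function.update α y w a = α a := by
    intro a ha
    have hne : a ≠ y := fun e => hy (e ▸ ha)
    exact Function.update_of_ne hne _ _
  have hαx := hα x hx
  refine ⟨?_, ?_, ?_, ?_, ?_, ?_, ?_, ?_⟩
  · intro r' a u v h1 h2 huv
    rcases hrel _ _ _ h1 with h1 | ⟨rfl, rfl, rfl⟩ <;>
    rcases hrel _ _ _ h2 with h2 | ⟨h2a, h2b, h2c⟩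
    · rw [hα _ (I.vrel _ _ _ h1).2, hα _ (I.vrel _ _ _ h2).2]
      exact I.inj _ _ _ _ h1 h2 huv
    · subst h2a h2b h2c
      rw [hα _ (I.vrel _ _ _ h1).2, Function.update_self]
      exact hw3 _ h1
    · rw [hα _ (I.vrel _ _ _ h2).2, Function.update_self]
      exact (hw3 _ h2).symm
    · exact absurd h2c.symm huv
  · intro a χ ha
    by_cases hay : a = y
    · subst hay
      rw [Function.update_self]
      rcases hsaty χ ha with rfl | ⟨ψ', m, -, rfl⟩
      · exact hw2
      · exact hfw _
    · rw [Function.update_of_ne hay]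
      exact I.sats _ _ ((hsat a hay χ).1 ha)
  · intro r' a u h1
    rcases hrel _ _ _ h1 with h1 | ⟨rfl, rfl, rfl⟩
    · rw [hα _ (I.vrel _ _ _ h1).2, hα _ (I.vrel _ _ _ h1).1]
      exact I.rels _ _ _ h1
    · rw [hαx, Function.update_self]; exact hw1
  · intro r' a u m χ h1 hg
    rcases hrel _ _ _ h1 with h1 | ⟨rfl, rfl, rfl⟩
    · have ha : a ≠ y := fun e => hy (e ▸ (I.vrel _ _ _ h1).1)
      rw [hsat a ha, hsat a ha] at hg
      exact (I.choice _ _ _ _ _ h1 hg).imp (fun h => hS h) (fun h => hS h)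
    · rw [hsat _ hxy, hsat _ hxy] at hg
      have : Constraint.sat u (f χ) ∈ S' := (hmem _).2 (Or.inr ⟨χ, m, hg, rfl⟩)
      rcases hf χ with e | e <;> rw [e] at this
      · exact Or.inl this
      · exact Or.inr this
  · intro r' a u h1
    rcases hrel _ _ _ h1 with h1 | ⟨rfl, rfl, rfl⟩
    · have ha : a ≠ y := fun e => hy (e ▸ (I.vrel _ _ _ h1).1)
      rw [app_congr (hsat a ha)]
      exact I.noapp _ _ _ h1
    · rw [app_congr (hsat _ hxy)]
      tauto
  · intro a χ ha
    by_cases hay : a = y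
    · simp [hay]
    · exact Finset.mem_insert_of_mem (I.vsat _ _ ((hsat a hay χ).1 ha))
  · intro r' a u h1
    rcases hrel _ _ _ h1 with h1 | ⟨rfl, rfl, rfl⟩
    · have := I.vrel _ _ _ h1
      exact ⟨Finset.mem_insert_of_mem this.1, Finset.mem_insert_of_mem this.2⟩
    · exact ⟨Finset.mem_insert_of_mem hx, Finset.mem_insert_self _ _⟩
  · intro a ha
    by_cases hay : a = y
    · subst hay; simpa using hBy
    · rw [Function.update_of_ne hay]
      by_cases hax : a = x
      · subst hax; simpa using hB
      · rw [Function.update_of_ne hax]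
        have haV : a ∈ V := by
          rcases Finset.mem_insert.1 ha with h | h
          · exact absurd h hay
          · exact h
        exact (I.bnd a haV).mono hS fun χ h => (hsat a hay χ).1 h

theorem main_aux (M : Kripke) (m : Multiset (ℕ × ℕ)) : ∀ S V α μ, m = meas V μ →
    Inv M S V α μ → ∃ S', Relation.ReflTransGen OptStep S S' ∧ OptComplete S' ∧ ¬ hasClash S' := by
  induction m using (WellFounded.cutExpand lx_wf).induction with
  | _ m ih =>
  intro S V α μ hm I
  subst hm
  by_cases hcomp : OptComplete S
  · exact ⟨S, .refl, hcomp, I.noClash⟩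
  · have key : ∃ S' V' α' μ', OptStep S S' ∧ Inv M S' V' α' μ' ∧
        Relation.CutExpand lx (meas V' μ') (meas V μ) := by
      unfold OptComplete at hcomp
      rw [not_not] at hcomp
      obtain ⟨S₁, h1 | h1 | h1⟩ := hcomp
      · obtain ⟨x, a, b, h, h2⟩ := h1
        have hs := I.sats _ _ h
        simp only [GFormula.sat] at hs
        obtain ⟨μ', h3, h4⟩ := I.localStep
          (insert (Constraint.sat x a) (insert (Constraint.sat x b) S)) x
          (Or.inl ⟨a, b, h, h2⟩) (fun c hc => by simp [hc]) {a, b}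
          (by
            intro c hc
            simp only [Finset.mem_insert] at hc
            rcases hc with rfl | rfl | hc
            · exact Or.inr ⟨a, by simp, rfl⟩
            · exact Or.inr ⟨b, by simp, rfl⟩
            · exact Or.inl hc)
          (by
            rintro χ (rfl | rfl)
            · exact hs.1
            · exact hs.2)
          (by
            intro C hC hL
            have := hC a b (Or.inl (hL _ h))
            rintro χ (rfl | rfl)
            · exact this.1
            · exact this.2)
          (by
            by_cases ha : Constraint.sat x a ∈ S
            · exact ⟨b, by simp, fun hb => h2 ⟨ha, hb⟩⟩
            · exact ⟨a, by simp, ha⟩)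
        exact ⟨_, V, α, μ', Or.inl (.mk S x a b h h2), h3, h4⟩
      · obtain ⟨x, a, b, -, h, h1, h2, -⟩ := h1
        have hs := I.sats _ _ h
        simp only [GFormula.sat] at hs
        obtain ⟨χ, hχ, hχs⟩ : ∃ χ, (χ = a ∨ χ = b) ∧ GFormula.sat M χ (α x) := by
          rcases hs with hs | hs
          · exact ⟨a, Or.inl rfl, hs⟩
          · exact ⟨b, Or.inr rfl, hs⟩
        obtain ⟨μ', h3, h4⟩ := I.localStep (insert (Constraint.sat x χ) S) x
          (Or.inr ⟨a, b, h, h1, h2⟩) (fun c hc => by simp [hc]) {χ}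
          (by
            intro c hc
            simp only [Finset.mem_insert] at hc
            rcases hc with rfl | hc
            · exact Or.inr ⟨χ, by simp, rfl⟩
            · exact Or.inl hc)
          (by rintro _ rfl; exact hχs)
          (by
            intro C hC hL
            have := hC a b (Or.inr (hL _ h))
            rintro _ rfl
            rcases hχ with rfl | rfl
            · exact this.1
            · exact this.2)
          (by
            refine ⟨χ, by simp, ?_⟩
            rcases hχ with rfl | rfl <;> assumption)
        exact ⟨_, V, α, μ', Or.inr (Or.inl (.mk S x a b χ h h1 h2 hχ)), h3, h4⟩
      · obtain ⟨x, r, n, ψ, _, _, h, hc, hna, hno, _, _, _⟩ := h1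
        obtain ⟨S', V', α', μ', h3, h4, h5⟩ := I.geStep h hc hna hno
        exact ⟨S', V', α', μ', Or.inr (Or.inr h3), h4, h5⟩
    obtain ⟨S', V', α', μ', h1, h2, h3⟩ := key
    obtain ⟨T, h4, h5⟩ := ih _ h3 S' V' α' μ' rfl h2
    exact ⟨T, .head h1 h4, h5⟩

end GrK

open GrK in
/-- completeness of the optimised algorithm: if φ (in NNF) is
satisfiable, then some sequence of applications of the optimised rules
starting from {x₀ ⊨ φ} yields a complete and clash-free c.s. -/
theorem stmt_11 (φ : GFormula) (hNNF : φ.isNNF) (hsat : φ.satisfiable) (x₀ : ℕ) :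
    ∃ S, OptReach x₀ φ S ∧ OptComplete S ∧ ¬ hasClash S := by
  obtain ⟨M, w, hw⟩ := hsat
  obtain ⟨b, hb⟩ := Bnd.exists (initCS x₀ φ) x₀ (md φ) (by
    intro ψ h
    simp only [initCS, Finset.mem_singleton, Constraint.sat.injEq, true_and] at h
    rw [h])
  refine main_aux M _ (initCS x₀ φ) {x₀} (fun _ => w) (fun _ => (md φ, b)) rfl ?_
  refine ⟨?_, ?_, ?_, ?_, ?_, ?_, ?_, ?_⟩
  · intro r x y z h; simp [initCS] at h
  · intro x ψ h
    simp only [initCS, Finset.mem_singleton, Constraint.sat.injEq] at h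
    rw [h.2]; exact hw
  · intro r x y h; simp [initCS] at h
  · intro r x y n ψ h; simp [initCS] at h
  · intro r x y h; simp [initCS] at h
  · intro x ψ h
    simp only [initCS, Finset.mem_singleton, Constraint.sat.injEq] at h
    simp [h.1]
  · intro r x y h; simp [initCS] at h
  · intro x hx
    rw [Finset.mem_singleton] at hx
    subst hx; exact hb
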